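/- Let n be a positive integer with n ∣ v_n. Then 2n ∣ v_{2n} if and only if every prime factor of n divides both P and Q, and moreover either P is even, or Q is odd and 3 divides n. -/

import Mathlib

/-- Lucas sequence of the second kind: `v 0 = 2`, `v 1 = P`,
`v (n+2) = P * v (n+1) - Q * v n`. -/
def lucasV (P Q : ℤ) : ℕ → ℤ
  | 0 => 2
  | 1 => P
  | n + 2 => P * lucasV P Q (n + 1) - Q * lucasV P Q n

theorem lucasV_add_two (P Q : ℤ) (n : ℕ) :
    lucasV P Q (n + 2) = P * lucasV P Q (n + 1) - Q * lucasV P Q n := rfl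

theorem lucasV_succ_sq (P Q : ℤ) (n : ℕ) :
    lucasV P Q (n + 1) ^ 2 - P * lucasV P Q n * lucasV P Q (n + 1) + Q * lucasV P Q n ^ 2 =
      (4 * Q - P ^ 2) * Q ^ n := by
  induction n with
  | zero => simp only [lucasV]; ring
  | succ n ih =>
    rw [lucasV_add_two]
    linear_combination Q * ih

theorem lucasV_doubling (P Q : ℤ) (n : ℕ) :
    lucasV P Q (2 * n) = lucasV P Q n ^ 2 - 2 * Q ^ n ∧
      lucasV P Q (2 * n + 1) = lucasV P Q n * lucasV P Q (n + 1) - P * Q ^ n := by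
  induction n with
  | zero => simp only [lucasV]; constructor <;> ring
  | succ n ih =>
    obtain ⟨h₀, h₁⟩ := ih
    have hsq := lucasV_succ_sq P Q n
    have h₂ : lucasV P Q (2 * n + 2) = lucasV P Q (n + 1) ^ 2 - 2 * Q ^ (n + 1) := by
      rw [lucasV_add_two, h₀, h₁]
      linear_combination -hsq
    refine ⟨h₂, ?_⟩
    have h₃ : lucasV P Q (2 * n + 3) =
        P * lucasV P Q (2 * n + 2) - Q * lucasV P Q (2 * n + 1) := rfl
    rw [show 2 * (n + 1) + 1 = 2 * n + 3 by ring, h₃, h₂, h₁, lucasV_add_two P Q n]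
    ring

theorem dvd_lucasV_succ_sub_pow (P Q : ℤ) (n : ℕ) :
    Q ∣ lucasV P Q (n + 1) - P ^ (n + 1) := by
  induction n with
  | zero => simp [lucasV]
  | succ n ih =>
    have h : lucasV P Q (n + 1 + 1) - P ^ (n + 1 + 1) =
        P * (lucasV P Q (n + 1) - P ^ (n + 1)) - Q * lucasV P Q n := by
      rw [lucasV_add_two]; ring
    rw [h]
    exact dvd_sub (ih.mul_left P) (dvd_mul_right _ _)

theorem dvd_left_of_dvd_lucasV {P Q : ℤ} {p n : ℕ} (hp : p.Prime) (hn : 0 < n)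
    (hQ : (p : ℤ) ∣ Q) (hv : (p : ℤ) ∣ lucasV P Q n) : (p : ℤ) ∣ P := by
  obtain ⟨m, rfl⟩ := Nat.exists_eq_add_of_lt hn
  rw [zero_add] at hv
  have h := dvd_sub hv (hQ.trans (dvd_lucasV_succ_sub_pow P Q m))
  rw [sub_sub_cancel] at h
  exact (Nat.prime_iff_prime_int.mp hp).dvd_of_dvd_pow h

theorem even_lucasV {P : ℤ} (hP : Even P) (Q : ℤ) (n : ℕ) : Even (lucasV P Q n) := by
  induction n using Nat.twoStepInduction with
  | zero => exact even_two
  | one => exact hP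
  | more n h₀ _ =>
    rw [lucasV_add_two]
    exact (hP.mul_right _).sub (h₀.mul_left _)

theorem even_lucasV_iff_three_dvd {P Q : ℤ} (hP : Odd P) (hQ : Odd Q) (n : ℕ) :
    Even (lucasV P Q n) ↔ 3 ∣ n := by
  induction n using Nat.strong_induction_on with
  | h n ih =>
    rcases n with _ | _ | _ | n
    · simp [lucasV]
    · simpa [lucasV] using hP
    · have h : ¬ Even (P * P - Q * 2) := by
        rw [Int.not_even_iff_odd]
        exact (hP.mul hP).sub_even (even_two.mul_left Q)
      simpa [lucasV] using h
    · have h : lucasV P Q (n + 3) =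
          (P * P - Q) * lucasV P Q (n + 1) - P * Q * lucasV P Q n := by
        have h₃ : lucasV P Q (n + 3) =
            P * lucasV P Q (n + 2) - Q * lucasV P Q (n + 1) := rfl
        rw [h₃, lucasV_add_two]; ring
      have hev : Even ((P * P - Q) * lucasV P Q (n + 1)) :=
        ((hP.mul hP).sub_odd hQ).mul_right _
      have hodd : ¬ Even (P * Q) := Int.not_even_iff_odd.mpr (hP.mul hQ)
      have hih := ih n (by omega)
      have hthree : 3 ∣ n + 3 ↔ 3 ∣ n := by omega
      change Even (lucasV P Q (n + 3)) ↔ 3 ∣ n + 3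
      rw [h, Int.even_sub, Int.even_mul (m := P * Q), hthree, ← hih]
      tauto

theorem even_lucasV_iff {P Q : ℤ} {n : ℕ} (hn : 0 < n) :
    Even (lucasV P Q n) ↔ Even P ∨ (Odd Q ∧ 3 ∣ n) := by
  rcases Int.even_or_odd P with hP | hP
  · simp [hP, even_lucasV hP]
  have hP' : ¬ Even P := Int.not_even_iff_odd.mpr hP
  rcases Int.even_or_odd Q with hQ | hQ
  · refine ⟨fun h => Or.inl ?_, fun h => ?_⟩
    · exact even_iff_two_dvd.mpr
        (dvd_left_of_dvd_lucasV Nat.prime_two hn hQ.two_dvd h.two_dvd)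
    · exact absurd h (by simp [hP', hQ])
  · simp [hP', hQ, even_lucasV_iff_three_dvd hP hQ]

theorem natCast_dvd_pow_self_of_forall_prime_dvd {Q : ℤ} {n : ℕ} (hn : 0 < n)
    (h : ∀ p : ℕ, p.Prime → p ∣ n → (p : ℤ) ∣ Q) : (n : ℤ) ∣ Q ^ n := by
  rw [Int.natCast_dvd, Int.natAbs_pow, Nat.dvd_iff_prime_pow_dvd_dvd]
  intro p k hp hk
  rcases Nat.eq_zero_or_pos k with rfl | hk0
  · simp
  have hkn : k ≤ n := (Nat.lt_pow_self hp.one_lt).le.trans (Nat.le_of_dvd hn hk)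
  have hpQ := Int.natCast_dvd.mp (h p hp ((dvd_pow_self p hk0.ne').trans hk))
  exact (pow_dvd_pow_of_dvd hpQ k).trans (pow_dvd_pow _ hkn)

theorem two_mul_dvd_sq_of_even {n : ℕ} {a : ℤ} (hn : Even n) (ha : (n : ℤ) ∣ a) :
    (2 * n : ℤ) ∣ a ^ 2 := by
  have h2 : (2 : ℤ) ∣ n := by exact_mod_cast hn.two_dvd
  rw [sq]
  exact mul_dvd_mul (h2.trans ha) ha

/-- For `n ∈ T`, `2n ∈ T` iff every prime factor of `n` is special
(divides both `P` and `Q`), and either `P` is even, or `Q` is odd and `3 ∣ n`. -/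
theorem lucasV_two_mul_mem_T_iff (P Q : ℤ) (n : ℕ) (hn : 0 < n)
    (hnT : (n : ℤ) ∣ lucasV P Q n) :
    ((2 * n : ℕ) : ℤ) ∣ lucasV P Q (2 * n) ↔
      ((∀ p : ℕ, p.Prime → p ∣ n → (p : ℤ) ∣ P ∧ (p : ℤ) ∣ Q) ∧
        (Even P ∨ (Odd Q ∧ 3 ∣ n))) := by
  rw [← even_lucasV_iff hn, (lucasV_doubling P Q n).1]
  push_cast
  constructor
  · intro h
    refine ⟨fun p hp hpn => ?_, ?_⟩
    · have hpn' : (p : ℤ) ∣ n := by exact_mod_cast hpn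
      have hpp := Nat.prime_iff_prime_int.mp hp
      have hQ : (p : ℤ) ∣ Q := by
        rcases hp.eq_two_or_odd' with rfl | hodd
        · have h' := (dvd_sub_right
            (two_mul_dvd_sq_of_even (even_iff_two_dvd.mpr hpn) hnT)).mp h
          exact hpp.dvd_of_dvd_pow
            (hpn'.trans (Int.dvd_of_mul_dvd_mul_left two_ne_zero h'))
        · have h' := (dvd_sub_right ((hpn'.trans hnT).pow two_ne_zero)).mp
            ((hpn'.mul_left 2).trans h)
          rcases hpp.dvd_or_dvd h' with h2 | hQn
          · have h2' : p ∣ 2 := by exact_mod_cast h2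
            rw [(Nat.prime_dvd_prime_iff_eq hp Nat.prime_two).mp h2'] at hodd
            exact absurd hodd (by decide)
          · exact hpp.dvd_of_dvd_pow hQn
      exact ⟨dvd_left_of_dvd_lucasV hp hn hQ (hpn'.trans hnT), hQ⟩
    · have h' := (dvd_sub_left (dvd_mul_right (2 : ℤ) (Q ^ n))).mp
        ((dvd_mul_right (2 : ℤ) n).trans h)
      exact even_iff_two_dvd.mpr (Int.prime_two.dvd_of_dvd_pow h')
  · rintro ⟨hspec, hev⟩
    have hQ : (2 * n : ℤ) ∣ 2 * Q ^ n := mul_dvd_mul_left 2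
      (natCast_dvd_pow_self_of_forall_prime_dvd hn fun p hp hpn => (hspec p hp hpn).2)
    refine dvd_sub ?_ hQ
    rcases Nat.even_or_odd n with hne | hno
    · exact two_mul_dvd_sq_of_even hne hnT
    · have hcop : IsCoprime (2 : ℤ) n := by
        exact_mod_cast Nat.isCoprime_iff_coprime.mpr (Nat.coprime_two_left.mpr hno)
      exact (hcop.mul_dvd hev.two_dvd hnT).trans (dvd_pow_self _ two_ne_zero)
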